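/- Let n, r_1, r_2 ≥ 0 be integers such that r_1 ≥ r_2 + n + 1. Let P ∈ ℚ[k_1, k_2] be a polynomial of degree at most 3n + 1 with respect to each variable, such that P(k_2 + r_2 − r_1, k_1 + r_1 − r_2) = −P(k_1, k_2). Then the series Σ_{k_1 ≥ k_2 ≥ 1} P(k_1, k_2) / ((k_1+r_1)_{n+1}^3 (k_2+r_2)_{n+1}^3) is a ℚ-linear combination of 1, ζ(2), ζ(3), and ζ(2, 3) − ζ(3, 2). -/

import Mathlib

/-- The value `ζ(s) = ∑_{k ≥ 1} 1/k^s` of the Riemann zeta function. -/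
noncomputable def zv (s : ℕ) : ℝ := ∑' k : ℕ+, ((k : ℝ) ^ s)⁻¹

/-- The double zeta value `ζ(s, t) = ∑_{k₁ > k₂ ≥ 1} 1/(k₁^s k₂^t)`. -/
noncomputable def dzv (s t : ℕ) : ℝ :=
  ∑' k : {q : ℕ × ℕ // q.2 < q.1 ∧ 1 ≤ q.2},
    ((k.1.1 : ℝ) ^ s * (k.1.2 : ℝ) ^ t)⁻¹

open Finset Filter Topology

/-- The function `x ↦ 1 / (x + 1 + i)^s` on the natural numbers. -/
noncomputable def invPow (i s : ℕ) (x : ℕ) : ℝ := (((x : ℝ) + 1 + i) ^ s)⁻¹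

/-- The function `x ↦ ∏_{i ∈ m} 1 / (x + 1 + i)` on the natural numbers. -/
noncomputable def recipProd (m : Multiset ℕ) (x : ℕ) : ℝ :=
  (m.map fun i : ℕ => ((x : ℝ) + 1 + i)⁻¹).prod

/-- Generators of the space of quadratically decaying rational functions whose poles have order at
most three and lie in `{-1, …, -(n + 1)}`. -/
noncomputable def decayGens (n : ℕ) : Set (ℕ → ℝ) :=
  {f | (∃ s, 2 ≤ s ∧ s ≤ 3 ∧ f = invPow 0 s) ∨
    ∃ i s, i < n ∧ 1 ≤ s ∧ s ≤ 3 ∧ f = invPow i s - invPow (i + 1) s}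

/-- The space of quadratically decaying rational functions whose poles have order at most three and
lie in `{-1, …, -(n + 1)}`. -/
noncomputable def decaySpan (n : ℕ) : Submodule ℚ (ℕ → ℝ) := Submodule.span ℚ (decayGens n)

lemma invPow_succ_apply (i s x : ℕ) : invPow i s (x + 1) = invPow (i + 1) s x := by
  simp only [invPow]
  push_cast
  ring_nf

lemma invPow_apply_add (i s x d : ℕ) : invPow i s (x + d) = invPow (i + d) s x := by
  simp only [invPow]
  push_cast
  ring_nf

lemma invPow_pos (i s x : ℕ) : 0 < invPow i s x := by
  unfold invPow
  positivity

lemma invPow_zero_sub_mem {n i s : ℕ} (hi : i ≤ n) (h1 : 1 ≤ s) (h3 : s ≤ 3) :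
    invPow 0 s - invPow i s ∈ decaySpan n := by
  induction i with
  | zero => simp
  | succ i ih =>
    have := (decaySpan n).add_mem (ih (by omega))
      (Submodule.subset_span (Or.inr ⟨i, s, by omega, h1, h3, rfl⟩))
    simpa using this

lemma invPow_sub_mem {n i j s : ℕ} (hi : i ≤ n) (hj : j ≤ n) (h1 : 1 ≤ s) (h3 : s ≤ 3) :
    invPow i s - invPow j s ∈ decaySpan n := by
  simpa using (decaySpan n).sub_mem (invPow_zero_sub_mem hj h1 h3) (invPow_zero_sub_mem hi h1 h3)

lemma invPow_mem {n i s : ℕ} (hi : i ≤ n) (h2 : 2 ≤ s) (h3 : s ≤ 3) :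
    invPow i s ∈ decaySpan n := by
  have h0 : invPow 0 s ∈ decaySpan n := Submodule.subset_span (Or.inl ⟨s, h2, h3, rfl⟩)
  simpa using (decaySpan n).sub_mem h0 (invPow_zero_sub_mem hi (by omega) h3)

lemma recipProd_cons (i : ℕ) (m : Multiset ℕ) (x : ℕ) :
    recipProd (i ::ₘ m) x = ((x : ℝ) + 1 + i)⁻¹ * recipProd m x := by
  simp [recipProd]

lemma recipProd_replicate (k i : ℕ) : recipProd (Multiset.replicate k i) = invPow i k := by
  ext x
  simp [recipProd, invPow]

lemma recipProd_add (m m' : Multiset ℕ) (x : ℕ) :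
    recipProd (m + m') x = recipProd m x * recipProd m' x := by
  simp [recipProd]

lemma recipProd_cons_cons {i j : ℕ} (hij : i ≠ j) (m : Multiset ℕ) :
    recipProd (i ::ₘ j ::ₘ m) =
      ((i : ℚ) - j)⁻¹ • (recipProd (j ::ₘ m) - recipProd (i ::ₘ m)) := by
  ext x
  have h : (i : ℝ) - j ≠ 0 := sub_ne_zero.mpr (by exact_mod_cast hij)
  have hi : (x : ℝ) + 1 + i ≠ 0 := by positivity
  have hj : (x : ℝ) + 1 + j ≠ 0 := by positivity
  simp only [recipProd_cons, Pi.smul_apply, Pi.sub_apply, Rat.smul_def]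
  push_cast
  field_simp
  ring

lemma recipProd_mem {n : ℕ} {m : Multiset ℕ} (hm : ∀ i ∈ m, i ≤ n) (h3 : ∀ i, m.count i ≤ 3)
    (h2 : 2 ≤ m.card) : recipProd m ∈ decaySpan n := by
  induction hk : m.card using Nat.strong_induction_on generalizing m with
  | _ k ih =>
  by_cases hall : ∃ i ∈ m, ∃ j ∈ m, i ≠ j
  · obtain ⟨i, hi, j, hj, hij⟩ := hall
    obtain ⟨m₁, rfl⟩ := Multiset.exists_cons_of_mem hi
    obtain ⟨m', rfl⟩ := Multiset.exists_cons_of_mem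
      ((Multiset.mem_cons.mp hj).resolve_left (Ne.symm hij))
    rw [recipProd_cons_cons hij]
    apply Submodule.smul_mem
    simp only [Multiset.card_cons] at hk h2
    by_cases h0 : m'.card = 0
    · obtain rfl := Multiset.card_eq_zero.mp h0
      have e : ∀ l : ℕ, recipProd (l ::ₘ 0) = invPow l 1 := fun l => recipProd_replicate 1 l
      rw [e, e]
      exact invPow_sub_mem (hm j (by simp)) (hm i (by simp)) le_rfl (by norm_num)
    · apply Submodule.sub_mem
      · refine ih _ ?_ (fun l hl => hm l (Multiset.mem_cons_of_mem hl))
          (fun l => (Multiset.count_le_count_cons _ _ _).trans (h3 l)) ?_ rfl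
        · rw [Multiset.card_cons]; omega
        · rw [Multiset.card_cons]; omega
      · rw [Multiset.cons_swap] at hm h3
        refine ih _ ?_ (fun l hl => hm l (Multiset.mem_cons_of_mem hl))
          (fun l => (Multiset.count_le_count_cons _ _ _).trans (h3 l)) ?_ rfl
        · rw [Multiset.card_cons]; omega
        · rw [Multiset.card_cons]; omega
  · push Not at hall
    obtain ⟨i, hi⟩ := Multiset.card_pos_iff_exists_mem.mp (show 0 < m.card by omega)
    have e : m = Multiset.replicate k i :=
      Multiset.eq_replicate.mpr ⟨hk, fun b hb => (hall i hi b hb).symm⟩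
    have hc := h3 i
    rw [e, Multiset.count_replicate_self] at hc
    rw [e, recipProd_replicate]
    exact invPow_mem (hm i hi) (by omega) hc

lemma eval_mul_recipProd_mem {n : ℕ} {m : Multiset ℕ} (hm : ∀ i ∈ m, i ≤ n)
    (h3 : ∀ i, m.count i ≤ 3) (q : Polynomial ℚ) (hq : q.natDegree + 2 ≤ m.card) :
    (fun x : ℕ => ((q.eval ((x : ℚ) + 1) : ℚ) : ℝ) * recipProd m x) ∈ decaySpan n := by
  induction m using Multiset.induction_on generalizing q with
  | empty => simp at hq
  | cons i m ih =>
    have hr := recipProd_mem hm h3 (by omega)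
    by_cases h0 : q.natDegree = 0
    · obtain ⟨c, rfl⟩ := Polynomial.natDegree_eq_zero.mp h0
      convert (decaySpan n).smul_mem c hr using 1
      ext x
      simp [Rat.smul_def]
    · set g : Polynomial ℚ := Polynomial.X - Polynomial.C (-(i : ℚ)) with hg
      have hmon : g.Monic := Polynomial.monic_X_sub_C _
      have hdeg : (q /ₘ g).natDegree = q.natDegree - 1 := by
        rw [Polynomial.natDegree_divByMonic _ hmon, Polynomial.natDegree_X_sub_C]
      have hdiv := Polynomial.modByMonic_add_div q g
      rw [Polynomial.modByMonic_X_sub_C_eq_C_eval] at hdiv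
      rw [Multiset.card_cons] at hq
      have h1 := ih (fun l hl => hm l (Multiset.mem_cons_of_mem hl))
          (fun l => (Multiset.count_le_count_cons _ _ _).trans (h3 l)) (q /ₘ g) (by omega)
      convert (decaySpan n).add_mem h1 ((decaySpan n).smul_mem (q.eval (-(i : ℚ))) hr) using 1
      ext x
      have hi : (x : ℝ) + 1 + i ≠ 0 := by positivity
      have he : q.eval ((x : ℚ) + 1) =
          q.eval (-(i : ℚ)) + ((x : ℚ) + 1 + i) * (q /ₘ g).eval ((x : ℚ) + 1) := by
        conv_lhs => rw [← hdiv]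
        simp [hg]
      rw [he]
      simp only [Pi.add_apply, Pi.smul_apply, Rat.smul_def, recipProd_cons]
      push_cast
      field_simp
      ring

lemma eval_div_ascPochhammer_mem {n : ℕ} (q : Polynomial ℚ) (hq : q.natDegree ≤ 3 * n + 1) :
    (fun x : ℕ => ((q.eval ((x : ℚ) + 1) : ℚ) : ℝ) /
      ((ascPochhammer ℝ (n + 1)).eval ((x : ℝ) + 1)) ^ 3) ∈ decaySpan n := by
  have hasc : ∀ (k x : ℕ), recipProd (Multiset.range k) x =
      ((ascPochhammer ℝ k).eval ((x : ℝ) + 1))⁻¹ := by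
    intro k x
    induction k with
    | zero => simp [recipProd]
    | succ k ih =>
      rw [Multiset.range_succ, recipProd_cons, ih, ascPochhammer_succ_eval, mul_inv, mul_comm]
  have key : ∀ x, recipProd (3 • Multiset.range (n + 1)) x =
      (((ascPochhammer ℝ (n + 1)).eval ((x : ℝ) + 1)) ^ 3)⁻¹ := by
    intro x
    rw [← inv_pow, ← hasc]
    simp [recipProd, Multiset.map_nsmul, Multiset.prod_nsmul]
  simp only [div_eq_mul_inv, ← key]
  refine eval_mul_recipProd_mem ?_ ?_ q ?_
  · intro i hi
    have := Multiset.mem_of_mem_nsmul hi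
    rw [Multiset.mem_range] at this
    omega
  · intro i
    have := Multiset.nodup_iff_count_le_one.mp (Multiset.nodup_range (n + 1)) i
    rw [Multiset.count_nsmul]
    omega
  · simp only [Multiset.card_nsmul, Multiset.card_range]
    omega

lemma invPow_mul_invPow_mem {i j s t : ℕ} (hij : i ≠ j) (hs : 1 ≤ s) (hs3 : s ≤ 3) (ht : 1 ≤ t)
    (ht3 : t ≤ 3) : (fun x => invPow i s x * invPow j t x) ∈ decaySpan (i + j) := by
  have : (fun x => invPow i s x * invPow j t x) =
      recipProd (Multiset.replicate s i + Multiset.replicate t j) := by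
    ext x
    rw [recipProd_add, recipProd_replicate, recipProd_replicate]
  rw [this]
  apply recipProd_mem
  · intro l hl
    rcases Multiset.mem_add.mp hl with h | h <;> rw [Multiset.eq_of_mem_replicate h] <;> omega
  · intro l
    rw [Multiset.count_add, Multiset.count_replicate, Multiset.count_replicate]
    split_ifs <;> omega
  · rw [Multiset.card_add, Multiset.card_replicate, Multiset.card_replicate]
    omega

lemma exists_decay_bound {n : ℕ} {e : ℕ → ℝ} (he : e ∈ decaySpan n) :
    ∃ C, 0 ≤ C ∧ ∀ x : ℕ, |e x| ≤ C * (((x : ℝ) + 1) ^ 2)⁻¹ := by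
  have hpow : ∀ i s x : ℕ, 2 ≤ s → invPow i s x ≤ (((x : ℝ) + 1) ^ 2)⁻¹ := by
    intro i s x hs
    unfold invPow
    have h1 : (1 : ℝ) ≤ (x : ℝ) + 1 + i := by
      have : (0 : ℝ) ≤ (x : ℝ) + i := by positivity
      linarith
    have h2 : ((x : ℝ) + 1) ^ 2 ≤ ((x : ℝ) + 1 + i) ^ 2 :=
      pow_le_pow_left₀ (by positivity) (le_add_of_nonneg_right i.cast_nonneg) 2
    have h3 : ((x : ℝ) + 1 + i) ^ 2 ≤ ((x : ℝ) + 1 + i) ^ s := pow_le_pow_right₀ h1 hs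
    exact inv_anti₀ (by positivity) (h2.trans h3)
  induction he using Submodule.span_induction with
  | mem f hf =>
    refine ⟨1, zero_le_one, fun x => ?_⟩
    rw [one_mul]
    rcases hf with ⟨s, h2, -, rfl⟩ | ⟨i, s, -, h1, -, rfl⟩
    · rw [abs_of_pos (invPow_pos _ _ _)]
      exact hpow _ _ _ h2
    · rw [Pi.sub_apply]
      rcases h1.eq_or_lt with rfl | h2
      · simp only [invPow, pow_one]
        push_cast
        have hi : (0 : ℝ) < (x : ℝ) + 1 + i := by positivity
        have : ((x : ℝ) + 1 + i)⁻¹ - ((x : ℝ) + 1 + (i + 1))⁻¹ =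
            (((x : ℝ) + 1 + i) * ((x : ℝ) + 1 + (i + 1)))⁻¹ := by
          field_simp
          ring
        rw [this, abs_of_pos (by positivity)]
        apply inv_anti₀ (by positivity)
        rw [pow_two]
        have : (0 : ℝ) ≤ i := i.cast_nonneg
        apply mul_le_mul <;> linarith [show (0 : ℝ) ≤ x from x.cast_nonneg]
      · exact abs_sub_le_of_nonneg_of_le (invPow_pos _ _ _).le (hpow _ _ _ h2)
          (invPow_pos _ _ _).le (hpow _ _ _ h2)
  | zero => exact ⟨0, le_rfl, fun x => by simp⟩
  | add f g _ _ hf hg =>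
    obtain ⟨C, hC, hf⟩ := hf
    obtain ⟨D, hD, hg⟩ := hg
    refine ⟨C + D, by positivity, fun x => ?_⟩
    rw [add_mul]
    exact (abs_add_le _ _).trans (add_le_add (hf x) (hg x))
  | smul c f _ hf =>
    obtain ⟨C, hC, hf⟩ := hf
    refine ⟨|(c : ℝ)| * C, by positivity, fun x => ?_⟩
    rw [Pi.smul_apply, Rat.smul_def, abs_mul, mul_assoc]
    exact mul_le_mul_of_nonneg_left (hf x) (abs_nonneg _)

lemma summable_inv_succ_sq : Summable fun x : ℕ => (((x : ℝ) + 1) ^ 2)⁻¹ := by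
  have := (summable_nat_add_iff (f := fun x : ℕ => ((x : ℝ) ^ 2)⁻¹) 1).mpr
    (Real.summable_nat_pow_inv.mpr one_lt_two)
  simpa using this

lemma summable_of_mem {n : ℕ} {e : ℕ → ℝ} (he : e ∈ decaySpan n) : Summable e := by
  obtain ⟨C, hC, h⟩ := exists_decay_bound he
  exact Summable.of_norm_bounded (summable_inv_succ_sq.mul_left C) h

lemma summable_shift_of_mem {n : ℕ} {e : ℕ → ℝ} (he : e ∈ decaySpan n) (r : ℕ) :
    Summable fun p => e (r + p) := by
  simpa only [add_comm r] using (summable_nat_add_iff r).mpr (summable_of_mem he)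

lemma summable_double {n : ℕ} {e e' : ℕ → ℝ} (he : e ∈ decaySpan n) (he' : e' ∈ decaySpan n)
    (r₁ r₂ : ℕ) : Summable fun p : ℕ × ℕ => e (r₁ + p.1 + p.2) * e' (r₂ + p.1) := by
  obtain ⟨C, hC, h⟩ := exists_decay_bound he
  obtain ⟨C', hC', h'⟩ := exists_decay_bound he'
  have hs : Summable fun p : ℕ × ℕ =>
      (C' * (((p.1 : ℝ) + 1) ^ 2)⁻¹) * (C * (((p.2 : ℝ) + 1) ^ 2)⁻¹) :=
    (summable_inv_succ_sq.mul_left C').mul_of_nonneg (summable_inv_succ_sq.mul_left C)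
      (fun x => by positivity) (fun x => by positivity)
  refine Summable.of_norm_bounded hs fun p => ?_
  rw [norm_mul, mul_comm]
  have mono : ∀ {c : ℝ} {a b : ℕ}, 0 ≤ c → a ≤ b →
      c * (((b : ℝ) + 1) ^ 2)⁻¹ ≤ c * (((a : ℝ) + 1) ^ 2)⁻¹ := by
    intro c a b hc hab
    gcongr
  exact mul_le_mul ((h' _).trans (mono hC' (by omega))) ((h _).trans (mono hC (by omega)))
    (norm_nonneg _) (by positivity)

/-- The `ℚ`-span of `1`, `ζ(2)` and `ζ(3)`. -/
noncomputable def zetaSpan : Submodule ℚ ℝ := Submodule.span ℚ {1, zv 2, zv 3}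

lemma ratCast_mem_zetaSpan (c : ℚ) : (c : ℝ) ∈ zetaSpan := by
  have := zetaSpan.smul_mem c (Submodule.subset_span (by simp) : (1 : ℝ) ∈ zetaSpan)
  simpa [Rat.smul_def] using this

lemma zv_mem_zetaSpan {s : ℕ} (h2 : 2 ≤ s) (h3 : s ≤ 3) : zv s ∈ zetaSpan := by
  apply Submodule.subset_span
  interval_cases s <;> simp

lemma exists_ratCast_eq_invPow (i s x : ℕ) : ∃ c : ℚ, (c : ℝ) = invPow i s x :=
  ⟨(((x : ℚ) + 1 + i) ^ s)⁻¹, by simp [invPow]⟩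

lemma invPow_mul_mem_zetaSpan (i s x : ℕ) {w : ℝ} (hw : w ∈ zetaSpan) :
    invPow i s x * w ∈ zetaSpan := by
  obtain ⟨c, hc⟩ := exists_ratCast_eq_invPow i s x
  rw [← hc, ← Rat.smul_def]
  exact zetaSpan.smul_mem c hw

lemma tendsto_invPow (i : ℕ) {s : ℕ} (hs : 1 ≤ s) : Tendsto (invPow i s) atTop (𝓝 0) := by
  have h : Tendsto (fun x : ℕ => (x : ℝ) + 1 + i) atTop atTop :=
    tendsto_atTop_add_const_right _ _
      (tendsto_atTop_add_const_right _ _ tendsto_natCast_atTop_atTop)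
  exact ((tendsto_pow_atTop (by omega)).comp h).inv_tendsto_atTop

lemma sum_range_invPow_sub (i s r k : ℕ) :
    ∑ p ∈ range k, (invPow i s - invPow (i + 1) s) (r + p) = invPow i s r - invPow i s (r + k) := by
  have h := Finset.sum_range_sub' (fun p => invPow i s (r + p)) k
  rw [add_zero] at h
  rw [← h]
  refine Finset.sum_congr rfl fun p _ => ?_
  rw [Pi.sub_apply, ← invPow_succ_apply, add_assoc]

lemma tsum_invPow_sub (i r : ℕ) {s : ℕ} (h1 : 1 ≤ s) (h3 : s ≤ 3) :
    ∑' p, (invPow i s - invPow (i + 1) s) (r + p) = invPow i s r := by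
  have hmem : invPow i s - invPow (i + 1) s ∈ decaySpan (i + 1) :=
    Submodule.subset_span (Or.inr ⟨i, s, by omega, h1, h3, rfl⟩)
  refine tendsto_nhds_unique (summable_shift_of_mem hmem r).hasSum.tendsto_sum_nat ?_
  simp only [sum_range_invPow_sub]
  have := (tendsto_invPow i h1).comp (tendsto_add_atTop_nat r)
  simpa [Function.comp_def, add_comm] using tendsto_const_nhds.sub this

lemma tsum_invPow_zero (s : ℕ) : ∑' p, invPow 0 s p = zv s := by
  rw [zv, tsum_pnat_eq_tsum_succ (f := fun k : ℕ => ((k : ℝ) ^ s)⁻¹)]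
  simp [invPow]

lemma tsum_shift_mem {n : ℕ} {e : ℕ → ℝ} (he : e ∈ decaySpan n) (r : ℕ) :
    ∑' p, e (r + p) ∈ zetaSpan := by
  induction he using Submodule.span_induction with
  | mem f hf =>
    have hf' : f ∈ decaySpan n := Submodule.subset_span hf
    rcases hf with ⟨s, h2, h3, rfl⟩ | ⟨i, s, -, h1, h3, rfl⟩
    · have h := (summable_of_mem hf').sum_add_tsum_nat_add r
      rw [tsum_invPow_zero] at h
      simp only [add_comm r]
      rw [← eq_sub_iff_add_eq'] at h
      rw [h]
      refine zetaSpan.sub_mem (zv_mem_zetaSpan h2 h3) (zetaSpan.sum_mem fun x _ => ?_)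
      obtain ⟨c, hc⟩ := exists_ratCast_eq_invPow 0 s x
      exact hc ▸ ratCast_mem_zetaSpan c
    · rw [tsum_invPow_sub i r h1 h3]
      obtain ⟨c, hc⟩ := exists_ratCast_eq_invPow i s r
      exact hc ▸ ratCast_mem_zetaSpan c
  | zero => simp
  | add f g hf hg ihf ihg =>
    simp only [Pi.add_apply]
    rw [(summable_shift_of_mem hf r).tsum_add (summable_shift_of_mem hg r)]
    exact zetaSpan.add_mem ihf ihg
  | smul c f hf ih =>
    simp only [Pi.smul_apply, Rat.smul_def, tsum_mul_left]
    rw [← Rat.smul_def]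
    exact zetaSpan.smul_mem c ih

/-- A product of an element of the decay space with poles moved away by a shift of `d` and a power
of `1 / (x + 1 + i)` with a different pole has tail sums in the span of `1`, `ζ(2)`, `ζ(3)`. -/
lemma tsum_mul_invPow_mem {n d i s : ℕ} {f : ℕ → ℝ} (hf : f ∈ decayGens n)
    (hi : ∀ j ≤ n, j + d ≠ i) (h1 : 1 ≤ s) (h3 : s ≤ 3) (r : ℕ) :
    Summable (fun p => f (r + p + d) * invPow i s (r + p)) ∧
      ∑' p, f (r + p + d) * invPow i s (r + p) ∈ zetaSpan := by
  have key : ∀ j ≤ n, ∀ t, 1 ≤ t → t ≤ 3 →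
      Summable (fun p => invPow j t (r + p + d) * invPow i s (r + p)) ∧
        ∑' p, invPow j t (r + p + d) * invPow i s (r + p) ∈ zetaSpan := by
    intro j hj t ht ht3
    have hm := invPow_mul_invPow_mem (hi j hj) ht ht3 h1 h3
    simp only [invPow_apply_add j t _ d]
    exact ⟨summable_shift_of_mem hm r, tsum_shift_mem hm r⟩
  rcases hf with ⟨t, ht, ht3, rfl⟩ | ⟨j, t, hj, ht, ht3, rfl⟩
  · exact key 0 (by omega) t (by omega) ht3
  · obtain ⟨s₁, m₁⟩ := key j (by omega) t ht ht3
    obtain ⟨s₂, m₂⟩ := key (j + 1) (by omega) t ht ht3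
    simp only [Pi.sub_apply, sub_mul]
    rw [s₁.tsum_sub s₂]
    exact ⟨s₁.sub s₂, zetaSpan.sub_mem m₁ m₂⟩

/-- The double sum of `e(a) e'(b)` over `b ≥ r₂` and `a ≥ b + (r₁ - r₂)`. -/
noncomputable def doubleSum (r₁ r₂ : ℕ) (e e' : ℕ → ℝ) : ℝ :=
  ∑' p : ℕ × ℕ, e (r₁ + p.1 + p.2) * e' (r₂ + p.1)

lemma doubleSum_left_mem {n r₁ r₂ i s : ℕ} {f : ℕ → ℝ} (hr : r₂ + n + 1 ≤ r₁) (hi : i < n)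
    (h1 : 1 ≤ s) (h3 : s ≤ 3) (hf : f ∈ decayGens n) :
    doubleSum r₁ r₂ (invPow i s - invPow (i + 1) s) f ∈ zetaSpan := by
  have hg : invPow i s - invPow (i + 1) s ∈ decaySpan n :=
    Submodule.subset_span (Or.inr ⟨i, s, hi, h1, h3, rfl⟩)
  rw [doubleSum, (summable_double hg (Submodule.subset_span hf) r₁ r₂).tsum_prod]
  simp only [tsum_mul_right, tsum_invPow_sub i _ h1 h3]
  obtain ⟨d, rfl⟩ := Nat.exists_eq_add_of_le (show r₂ ≤ r₁ by omega)
  have := (tsum_mul_invPow_mem (d := 0) (i := i + d) hf (fun j hj => by omega) h1 h3 r₂).2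
  refine (congrArg (· ∈ zetaSpan) (tsum_congr fun p => ?_)).mpr this
  rw [mul_comm, ← invPow_apply_add, add_zero]
  congr 2
  omega

lemma doubleSum_right_mem {n r₁ r₂ i s : ℕ} {f : ℕ → ℝ} (hr : r₂ + n + 1 ≤ r₁) (hi : i < n)
    (h1 : 1 ≤ s) (h3 : s ≤ 3) (hf : f ∈ decayGens n) :
    doubleSum r₁ r₂ f (invPow i s - invPow (i + 1) s) ∈ zetaSpan := by
  have hg : invPow i s - invPow (i + 1) s ∈ decaySpan n :=
    Submodule.subset_span (Or.inr ⟨i, s, hi, h1, h3, rfl⟩)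
  have hf' : f ∈ decaySpan n := Submodule.subset_span hf
  have hsum := summable_double hf' hg r₁ r₂
  have hsig := (Finset.HasAntidiagonal.sigmaAntidiagonalEquivProd.summable_iff.mpr hsum).tsum_sigma'
    (fun m => (hasSum_fintype _).summable)
  rw [Function.comp_def] at hsig
  rw [doubleSum, ← Finset.HasAntidiagonal.sigmaAntidiagonalEquivProd.tsum_eq, hsig]
  obtain ⟨d, rfl⟩ := Nat.exists_eq_add_of_le (show r₂ ≤ r₁ by omega)
  have hinner : ∀ m : ℕ, ∑' c : antidiagonal m,
      f (r₂ + d + (c : ℕ × ℕ).1 + (c : ℕ × ℕ).2) *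
        (invPow i s - invPow (i + 1) s) (r₂ + (c : ℕ × ℕ).1) =
      invPow i s r₂ * f (r₂ + d + m) - f (r₂ + m + d) * invPow (i + 1) s (r₂ + m) := by
    intro m
    rw [tsum_fintype, Finset.sum_coe_sort (antidiagonal m) (fun c : ℕ × ℕ =>
      f (r₂ + d + c.1 + c.2) * (invPow i s - invPow (i + 1) s) (r₂ + c.1)),
      Finset.Nat.sum_antidiagonal_eq_sum_range_succ_mk]
    have : ∀ k ∈ range (m + 1), f (r₂ + d + k + (m - k)) *
        (invPow i s - invPow (i + 1) s) (r₂ + k) =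
        f (r₂ + d + m) * (invPow i s - invPow (i + 1) s) (r₂ + k) := by
      intro k hk
      rw [mem_range] at hk
      congr 2
      omega
    rw [Finset.sum_congr rfl this, ← Finset.mul_sum, sum_range_invPow_sub, ← add_assoc,
      invPow_succ_apply, add_right_comm r₂ m d]
    ring
  obtain ⟨hs, hm⟩ := tsum_mul_invPow_mem (d := d) (i := i + 1) hf (fun j hj => by omega) h1 h3 r₂
  have := zetaSpan.sub_mem (invPow_mul_mem_zetaSpan i s r₂ (tsum_shift_mem hf' (r₂ + d))) hm
  rw [← tsum_mul_left, ← ((summable_shift_of_mem hf' (r₂ + d)).mul_left _).tsum_sub hs] at this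
  exact (congrArg (· ∈ zetaSpan) (tsum_congr hinner)).mpr this

lemma doubleSum_sub_succ_left {n : ℕ} {e e' : ℕ → ℝ} (he : e ∈ decaySpan n)
    (he' : e' ∈ decaySpan n) (r₁ r₂ : ℕ) :
    doubleSum r₁ r₂ e e' - doubleSum (r₁ + 1) r₂ e e' = ∑' p, e (r₁ + p) * e' (r₂ + p) := by
  have h := summable_double he he' r₁ r₂
  have h' := summable_double he he' (r₁ + 1) r₂
  rw [doubleSum, doubleSum, h.tsum_prod, h'.tsum_prod, ← h.prod.tsum_sub h'.prod]
  congr 1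
  ext p
  rw [(h.prod_factor p).tsum_eq_zero_add]
  simp only [add_zero, add_right_comm r₁ 1, add_assoc, add_comm 1]
  simp

lemma doubleSum_sub_succ_succ {n : ℕ} {e e' : ℕ → ℝ} (he : e ∈ decaySpan n)
    (he' : e' ∈ decaySpan n) (r₁ r₂ : ℕ) :
    doubleSum r₁ r₂ e e' - doubleSum (r₁ + 1) (r₂ + 1) e e' = e' r₂ * ∑' q, e (r₁ + q) := by
  have h := summable_double he he' r₁ r₂
  have h' := summable_double he he' (r₁ + 1) (r₂ + 1)
  rw [doubleSum, doubleSum, h.tsum_prod, h'.tsum_prod, h.prod.tsum_eq_zero_add]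
  simp only [add_zero, tsum_mul_right, add_assoc, add_comm 1]
  ring

lemma doubleSum_invPow_sub_mem {s t : ℕ} (hs : 2 ≤ s) (hs3 : s ≤ 3) (ht : 2 ≤ t) (ht3 : t ≤ 3)
    {r₁ r₂ : ℕ} (hr : r₂ < r₁) :
    doubleSum r₁ r₂ (invPow 0 s) (invPow 0 t) - doubleSum 1 0 (invPow 0 s) (invPow 0 t) ∈
      zetaSpan := by
  have hsm : invPow 0 s ∈ decaySpan 0 := invPow_mem le_rfl hs hs3
  have htm : invPow 0 t ∈ decaySpan 0 := invPow_mem le_rfl ht ht3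
  obtain ⟨k, rfl⟩ := Nat.exists_eq_add_of_lt hr
  clear hr
  induction k with
  | zero =>
    induction r₂ with
    | zero => simp
    | succ r ih =>
      have h := doubleSum_sub_succ_succ hsm htm (r + 0 + 1) r
      have hm := zetaSpan.sub_mem ih
        (invPow_mul_mem_zetaSpan 0 t r (tsum_shift_mem hsm (r + 0 + 1)))
      rw [← h] at hm
      simpa using hm
  | succ k ih =>
    have h := doubleSum_sub_succ_left hsm htm (r₂ + k + 1) r₂
    have hm := (tsum_mul_invPow_mem (d := k + 1) (i := 0) (n := 0) (s := t)
      (Or.inl ⟨s, hs, hs3, rfl⟩) (fun j hj => by omega) (by omega) ht3 r₂).2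
    simp only [show ∀ p, r₂ + p + (k + 1) = r₂ + k + 1 + p from fun p => by omega] at hm
    rw [← h] at hm
    simpa [add_assoc] using zetaSpan.sub_mem ih hm

/-- The `ℚ`-span of `1`, `ζ(2)`, `ζ(3)` and `ζ(2, 3) - ζ(3, 2)`. -/
noncomputable def doubleZetaSpan : Submodule ℚ ℝ :=
  Submodule.span ℚ {1, zv 2, zv 3, dzv 2 3 - dzv 3 2}

lemma zetaSpan_le_doubleZetaSpan : zetaSpan ≤ doubleZetaSpan := by
  apply Submodule.span_mono
  intro x hx
  simp only [Set.mem_insert_iff, Set.mem_singleton_iff] at hx ⊢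
  tauto

/-- The index pairs `k₁ ≥ k₂ + d`, `k₂ ≥ 1`, written as `k₂ = p + 1`, `k₁ = p + 1 + d + q`. -/
def pairEquiv (d : ℕ) : ℕ × ℕ ≃ {q : ℕ × ℕ // q.2 + d ≤ q.1 ∧ 1 ≤ q.2} where
  toFun p := ⟨(p.1 + 1 + d + p.2, p.1 + 1), by dsimp only; omega⟩
  invFun k := (k.1.2 - 1, k.1.1 - k.1.2 - d)
  left_inv p := by
    ext <;> dsimp only <;> omega
  right_inv k := by
    obtain ⟨⟨a, b⟩, h₁, h₂⟩ := k
    ext <;> dsimp only at * <;> omega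

lemma dzv_eq_doubleSum (s t : ℕ) : dzv s t = doubleSum 1 0 (invPow 0 s) (invPow 0 t) := by
  rw [dzv, doubleSum]
  refine ((pairEquiv 1).tsum_eq (fun k : {q : ℕ × ℕ // q.2 < q.1 ∧ 1 ≤ q.2} =>
    ((k.1.1 : ℝ) ^ s * (k.1.2 : ℝ) ^ t)⁻¹)).symm.trans (tsum_congr fun p => ?_)
  simp only [pairEquiv, Equiv.coe_fn_mk, invPow, mul_inv]
  push_cast
  ring_nf

lemma doubleSum_invPow_sub_swap_mem {s t r₁ r₂ : ℕ} (hs : 2 ≤ s) (hs3 : s ≤ 3) (ht : 2 ≤ t)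
    (ht3 : t ≤ 3) (hr : r₂ < r₁) :
    doubleSum r₁ r₂ (invPow 0 s) (invPow 0 t) - doubleSum r₁ r₂ (invPow 0 t) (invPow 0 s) ∈
      doubleZetaSpan := by
  have h₁ := zetaSpan_le_doubleZetaSpan (doubleSum_invPow_sub_mem hs hs3 ht ht3 hr)
  have h₂ := zetaSpan_le_doubleZetaSpan (doubleSum_invPow_sub_mem ht ht3 hs hs3 hr)
  rw [← dzv_eq_doubleSum] at h₁ h₂
  have h : dzv s t - dzv t s ∈ doubleZetaSpan := by
    have h23 : dzv 2 3 - dzv 3 2 ∈ doubleZetaSpan := Submodule.subset_span (by simp)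
    interval_cases s <;> interval_cases t
    · simp
    · exact h23
    · simpa using doubleZetaSpan.neg_mem h23
    · simp
  convert doubleZetaSpan.add_mem (doubleZetaSpan.sub_mem h₁ h₂) h using 1
  ring

lemma doubleSum_add_left {n : ℕ} {e f g : ℕ → ℝ} (he : e ∈ decaySpan n) (hf : f ∈ decaySpan n)
    (hg : g ∈ decaySpan n) (r₁ r₂ : ℕ) :
    doubleSum r₁ r₂ (e + f) g = doubleSum r₁ r₂ e g + doubleSum r₁ r₂ f g := by
  simp only [doubleSum, Pi.add_apply, add_mul]
  exact (summable_double he hg r₁ r₂).tsum_add (summable_double hf hg r₁ r₂)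

lemma doubleSum_add_right {n : ℕ} {e f g : ℕ → ℝ} (he : e ∈ decaySpan n) (hf : f ∈ decaySpan n)
    (hg : g ∈ decaySpan n) (r₁ r₂ : ℕ) :
    doubleSum r₁ r₂ e (f + g) = doubleSum r₁ r₂ e f + doubleSum r₁ r₂ e g := by
  simp only [doubleSum, Pi.add_apply, mul_add]
  exact (summable_double he hf r₁ r₂).tsum_add (summable_double he hg r₁ r₂)

lemma doubleSum_smul_left (c : ℚ) (e f : ℕ → ℝ) (r₁ r₂ : ℕ) :
    doubleSum r₁ r₂ (c • e) f = c • doubleSum r₁ r₂ e f := by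
  simp only [doubleSum, Pi.smul_apply, Rat.smul_def, mul_assoc, tsum_mul_left]

lemma doubleSum_smul_right (c : ℚ) (e f : ℕ → ℝ) (r₁ r₂ : ℕ) :
    doubleSum r₁ r₂ e (c • f) = c • doubleSum r₁ r₂ e f := by
  simp only [doubleSum, Pi.smul_apply, Rat.smul_def, mul_left_comm _ (c : ℝ), tsum_mul_left]

lemma doubleSum_sub_swap_mem {n r₁ r₂ : ℕ} (hr : r₂ + n + 1 ≤ r₁) {e e' : ℕ → ℝ}
    (he : e ∈ decaySpan n) (he' : e' ∈ decaySpan n) :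
    doubleSum r₁ r₂ e e' - doubleSum r₁ r₂ e' e ∈ doubleZetaSpan := by
  induction he, he' using Submodule.span_induction₂ with
  | mem_mem f g hf hg =>
    have hf' := hf
    have hg' := hg
    rcases hf with ⟨s, hs, hs3, rfl⟩ | ⟨i, s, hi, hs, hs3, rfl⟩
    · rcases hg with ⟨t, ht, ht3, rfl⟩ | ⟨j, t, hj, ht, ht3, rfl⟩
      · exact doubleSum_invPow_sub_swap_mem hs hs3 ht ht3 (by omega)
      · exact zetaSpan_le_doubleZetaSpan (zetaSpan.sub_mem
          (doubleSum_right_mem hr hj ht ht3 hf') (doubleSum_left_mem hr hj ht ht3 hf'))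
    · exact zetaSpan_le_doubleZetaSpan (zetaSpan.sub_mem
        (doubleSum_left_mem hr hi hs hs3 hg') (doubleSum_right_mem hr hi hs hs3 hg'))
  | zero_left g hg => simp [doubleSum]
  | zero_right f hf => simp [doubleSum]
  | add_left e f g he hf hg h₁ h₂ =>
    rw [doubleSum_add_left he hf hg, doubleSum_add_right hg he hf, add_sub_add_comm]
    exact doubleZetaSpan.add_mem h₁ h₂
  | add_right e f g he hf hg h₁ h₂ =>
    rw [doubleSum_add_right he hf hg, doubleSum_add_left hf hg he, add_sub_add_comm]
    exact doubleZetaSpan.add_mem h₁ h₂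
  | smul_left c e f _ _ h =>
    rw [doubleSum_smul_left, doubleSum_smul_right, ← smul_sub]
    exact doubleZetaSpan.smul_mem c h
  | smul_right c e f _ _ h =>
    rw [doubleSum_smul_left, doubleSum_smul_right, ← smul_sub]
    exact doubleZetaSpan.smul_mem c h

/-- The function `x ↦ (x + 1 - r)^u / (x + 1)_{n + 1}^3` on the natural numbers. -/
noncomputable def shiftedPowDiv (n r u : ℕ) (x : ℕ) : ℝ :=
  ((x : ℝ) + 1 - r) ^ u / ((ascPochhammer ℝ (n + 1)).eval ((x : ℝ) + 1)) ^ 3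

lemma shiftedPowDiv_mem {n r u : ℕ} (hu : u ≤ 3 * n + 1) :
    shiftedPowDiv n r u ∈ decaySpan n := by
  have := eval_div_ascPochhammer_mem (n := n) ((Polynomial.X - Polynomial.C (r : ℚ)) ^ u) (by
    rw [Polynomial.natDegree_pow, Polynomial.natDegree_X_sub_C]
    omega)
  convert this using 1
  ext x
  simp [shiftedPowDiv]

lemma eval_div_eq_sum (n r₁ r₂ : ℕ) (P : MvPolynomial (Fin 2) ℚ) (x y : ℕ) :
    ((MvPolynomial.eval ![(x : ℚ) + 1 - r₁, (y : ℚ) + 1 - r₂] P : ℚ) : ℝ) /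
        (((ascPochhammer ℝ (n + 1)).eval ((x : ℝ) + 1)) ^ 3 *
          ((ascPochhammer ℝ (n + 1)).eval ((y : ℝ) + 1)) ^ 3) =
      ∑ m ∈ P.support, ((P.coeff m : ℚ) : ℝ) *
        (shiftedPowDiv n r₁ (m 0) x * shiftedPowDiv n r₂ (m 1) y) := by
  rw [MvPolynomial.eval_eq', Rat.cast_sum, Finset.sum_div]
  refine Finset.sum_congr rfl fun m _ => ?_
  simp only [Fin.prod_univ_two, shiftedPowDiv, Matrix.cons_val_zero, Matrix.cons_val_one]
  push_cast
  rw [div_mul_div_comm, mul_div_assoc]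

theorem statement16 (n r₁ r₂ : ℕ) (hr : r₂ + n + 1 ≤ r₁)
    (P : MvPolynomial (Fin 2) ℚ)
    (hdeg : ∀ i : Fin 2, P.degreeOf i ≤ 3 * n + 1)
    (hsym : ∀ x y : ℚ,
      MvPolynomial.eval ![y + (r₂ : ℚ) - r₁, x + (r₁ : ℚ) - r₂] P
        = -MvPolynomial.eval ![x, y] P) :
    Summable (fun k : {q : ℕ × ℕ // q.2 ≤ q.1 ∧ 1 ≤ q.2} =>
        ((MvPolynomial.eval ![(k.1.1 : ℚ), (k.1.2 : ℚ)] P : ℚ) : ℝ) /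
          (((ascPochhammer ℝ (n + 1)).eval ((k.1.1 : ℝ) + r₁)) ^ 3 *
            ((ascPochhammer ℝ (n + 1)).eval ((k.1.2 : ℝ) + r₂)) ^ 3)) ∧
    ∃ a b c d : ℚ,
      (∑' k : {q : ℕ × ℕ // q.2 ≤ q.1 ∧ 1 ≤ q.2},
          ((MvPolynomial.eval ![(k.1.1 : ℚ), (k.1.2 : ℚ)] P : ℚ) : ℝ) /
            (((ascPochhammer ℝ (n + 1)).eval ((k.1.1 : ℝ) + r₁)) ^ 3 *
              ((ascPochhammer ℝ (n + 1)).eval ((k.1.2 : ℝ) + r₂)) ^ 3))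
        = a + b * zv 2 + c * zv 3 + d * (dzv 2 3 - dzv 3 2) := by
  set F : {q : ℕ × ℕ // q.2 ≤ q.1 ∧ 1 ≤ q.2} → ℝ := fun k =>
    ((MvPolynomial.eval ![(k.1.1 : ℚ), (k.1.2 : ℚ)] P : ℚ) : ℝ) /
      (((ascPochhammer ℝ (n + 1)).eval ((k.1.1 : ℝ) + r₁)) ^ 3 *
        ((ascPochhammer ℝ (n + 1)).eval ((k.1.2 : ℝ) + r₂)) ^ 3) with hF
  obtain ⟨φ, hφ⟩ : ∃ φ : ℕ × ℕ ≃ {q : ℕ × ℕ // q.2 ≤ q.1 ∧ 1 ≤ q.2},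
      ∀ p, (φ p).1 = (p.1 + 1 + p.2, p.1 + 1) := ⟨pairEquiv 0, fun _ => rfl⟩
  have hmem : ∀ m ∈ P.support, ∀ (i : Fin 2) (r : ℕ), shiftedPowDiv n r (m i) ∈ decaySpan n :=
    fun m hm i r => shiftedPowDiv_mem ((MvPolynomial.monomial_le_degreeOf i hm).trans (hdeg i))
  have hterm : ∀ p : ℕ × ℕ, F (φ p) = ∑ m ∈ P.support, ((P.coeff m : ℚ) : ℝ) *
      (shiftedPowDiv n r₁ (m 0) (r₁ + p.1 + p.2) * shiftedPowDiv n r₂ (m 1) (r₂ + p.1)) := by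
    intro p
    rw [← eval_div_eq_sum, hF]
    simp only [hφ]
    push_cast
    ring_nf
  have hswap : ∀ x y : ℕ, ∑ m ∈ P.support, ((P.coeff m : ℚ) : ℝ) *
      (shiftedPowDiv n r₂ (m 1) x * shiftedPowDiv n r₁ (m 0) y) =
      -∑ m ∈ P.support, ((P.coeff m : ℚ) : ℝ) *
        (shiftedPowDiv n r₁ (m 0) x * shiftedPowDiv n r₂ (m 1) y) := by
    intro x y
    simp only [mul_comm (shiftedPowDiv n r₂ _ x)]
    rw [← eval_div_eq_sum, ← eval_div_eq_sum, ← neg_div, ← Rat.cast_neg, ← hsym,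
      mul_comm (Polynomial.eval _ _ ^ 3)]
    ring_nf
  have hS : ∀ m ∈ P.support, Summable fun p : ℕ × ℕ => ((P.coeff m : ℚ) : ℝ) *
      (shiftedPowDiv n r₁ (m 0) (r₁ + p.1 + p.2) * shiftedPowDiv n r₂ (m 1) (r₂ + p.1)) :=
    fun m hm => (summable_double (hmem m hm 0 r₁) (hmem m hm 1 r₂) r₁ r₂).mul_left _
  have hS' : ∀ m ∈ P.support, Summable fun p : ℕ × ℕ => ((P.coeff m : ℚ) : ℝ) *
      (shiftedPowDiv n r₂ (m 1) (r₁ + p.1 + p.2) * shiftedPowDiv n r₁ (m 0) (r₂ + p.1)) :=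
    fun m hm => (summable_double (hmem m hm 1 r₂) (hmem m hm 0 r₁) r₁ r₂).mul_left _
  have hsum : Summable F := by
    rw [← φ.summable_iff]
    exact (summable_sum hS).congr fun p => (hterm p).symm
  refine ⟨hsum, ?_⟩
  have h₁ : ∑' k, F k = ∑ m ∈ P.support, ((P.coeff m : ℚ) : ℝ) *
      doubleSum r₁ r₂ (shiftedPowDiv n r₁ (m 0)) (shiftedPowDiv n r₂ (m 1)) := by
    rw [← φ.tsum_eq F, tsum_congr hterm, Summable.tsum_finsetSum hS]
    simp only [tsum_mul_left, doubleSum]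
  have h₂ : -∑' k, F k = ∑ m ∈ P.support, ((P.coeff m : ℚ) : ℝ) *
      doubleSum r₁ r₂ (shiftedPowDiv n r₂ (m 1)) (shiftedPowDiv n r₁ (m 0)) := by
    rw [← φ.tsum_eq F, ← tsum_neg]
    simp only [hterm, ← hswap]
    rw [Summable.tsum_finsetSum hS']
    simp only [tsum_mul_left, doubleSum]
  have h₃ : ∑' k, F k ∈ doubleZetaSpan := by
    have h : ∑' k, F k = (2⁻¹ : ℚ) • ∑ m ∈ P.support, P.coeff m •
        (doubleSum r₁ r₂ (shiftedPowDiv n r₁ (m 0)) (shiftedPowDiv n r₂ (m 1)) -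
          doubleSum r₁ r₂ (shiftedPowDiv n r₂ (m 1)) (shiftedPowDiv n r₁ (m 0))) := by
      simp only [Rat.smul_def, mul_sub, Finset.sum_sub_distrib]
      rw [← mul_sub, ← h₁, ← h₂]
      push_cast
      ring
    rw [h]
    exact doubleZetaSpan.smul_mem _ (doubleZetaSpan.sum_mem fun m hm =>
      doubleZetaSpan.smul_mem _ (doubleSum_sub_swap_mem hr (hmem m hm 0 r₁) (hmem m hm 1 r₂)))
  obtain ⟨a, z, hz, h⟩ := Submodule.mem_span_insert.mp h₃
  obtain ⟨b, c, d, rfl⟩ := Submodule.mem_span_triple.mp hz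
  refine ⟨a, b, c, d, ?_⟩
  rw [h]
  simp only [Rat.smul_def]
  ring
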